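/- In the translationally invariant spin-chain setting with ⟨H_1²⟩ > 0, for any fixed even m with 2 ≤ m = O(1) the average entanglement entropy of all eigenstates over a region of m consecutive spins satisfies m·ln 2 − c₁/n ≤ S̄ ≤ m·ln 2 − c₂/n for some constants c₁ ≥ c₂ > 0 independent of n; in particular the upper bound S̄ ≤ m·ln 2 − m⟨H_1²⟩/(4n) holds. -/

import Mathlib

open Finset Matrix
open scoped ComplexOrder

noncomputable section

/-- The Hilbert space of a chain of `n` spin-1/2's, `(ℂ²)^{⊗n}`, in the computational basis:
a state assigns an amplitude to each configuration `Fin n → Fin 2`. -/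
abbrev QState (n : ℕ) : Type := (Fin n → Fin 2) → ℂ

/-- Operators on the chain of `n` spin-1/2's. -/
abbrev QOp (n : ℕ) : Type := Matrix (Fin n → Fin 2) (Fin n → Fin 2) ℂ

/-- von Neumann entropy `S(ρ) = -tr(ρ ln ρ)` (natural logarithm), via eigenvalues. -/
noncomputable def vnEntropy {ι : Type} [Fintype ι] [DecidableEq ι] (ρ : Matrix ι ι ℂ) : ℝ := by
  classical
  exact if h : ρ.IsHermitian then -∑ i, h.eigenvalues i * Real.log (h.eigenvalues i) else 0

/-- Operator norm (`ℓ² → ℓ²`) of a matrix. -/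
noncomputable def opNorm {ι : Type} [Fintype ι] [DecidableEq ι] (M : Matrix ι ι ℂ) : ℝ :=
  ‖LinearMap.toContinuousLinearMap (Matrix.toEuclideanLin M)‖

/-- Combine a configuration of the first `m` sites with one of the remaining `n - m` sites. -/
def joinCfg (n m : ℕ) (a : Fin m → Fin 2) (b : Fin (n - m) → Fin 2) : Fin n → Fin 2 :=
  fun i => if hi : (i : ℕ) < m then a ⟨i, hi⟩ else b ⟨(i : ℕ) - m, by have := i.isLt; omega⟩

/-- Reduced density matrix `ρ_A = tr_B |ψ⟩⟨ψ|` of a pure state, where `A` consists of the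
first `m` spins and `B` of the remaining `n - m` spins. -/
noncomputable def rdm (n m : ℕ) (ψ : QState n) :
    Matrix (Fin m → Fin 2) (Fin m → Fin 2) ℂ :=
  fun a a' => ∑ b : Fin (n - m) → Fin 2,
    ψ (joinCfg n m a b) * (starRingEnd ℂ) (ψ (joinCfg n m a' b))

/-- Entanglement entropy of a pure state between the first `m` spins and the rest. -/
noncomputable def entEntropy (n m : ℕ) (ψ : QState n) : ℝ := vnEntropy (rdm n m ψ)

/-- The cyclic successor `i + 1 (mod n)` of a site of the periodic chain. -/
def finSucc {n : ℕ} (i : Fin n) : Fin n := ⟨((i : ℕ) + 1) % n, Nat.mod_lt _ i.pos⟩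

/-- Translation (cyclic shift by one site) acting on configurations. -/
def shiftCfg {n : ℕ} (σ : Fin n → Fin 2) : Fin n → Fin 2 := fun i => σ (finSucc i)

/-- `M` acts only on the sites in `S`, i.e. `M = K ⊗ 1` with `K` supported on `S`:
matrix elements vanish unless the configurations agree off `S`, and they depend only on
the restriction of the configurations to `S`. -/
def ActsOn {n : ℕ} (S : Finset (Fin n)) (M : QOp n) : Prop :=
  (∀ σ τ : Fin n → Fin 2, (∃ i ∉ S, σ i ≠ τ i) → M σ τ = 0) ∧
  (∀ σ τ σ' τ' : Fin n → Fin 2, (∀ i ∈ S, σ i = σ' i) → (∀ i ∈ S, τ i = τ' i) →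
    (∀ i ∉ S, σ i = τ i) → (∀ i ∉ S, σ' i = τ' i) → M σ τ = M σ' τ')

/-- The translationally invariant local term: the two-site operator `h` placed on the
(cyclically) adjacent sites `i, i+1` of the `n`-site chain, tensored with the identity. -/
def twoSite (n : ℕ) (h : Matrix (Fin 2 × Fin 2) (Fin 2 × Fin 2) ℂ) (i : Fin n) : QOp n :=
  fun σ τ =>
    if ∀ j : Fin n, j ≠ i → j ≠ finSucc i → σ j = τ j then
      h (σ i, σ (finSucc i)) (τ i, τ (finSucc i))
    else 0


lemma vnEntropy_eq {ι : Type} [Fintype ι] [DecidableEq ι] (ρ : Matrix ι ι ℂ)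
    (h : ρ.IsHermitian) :
    vnEntropy ρ = -∑ i, h.eigenvalues i * Real.log (h.eigenvalues i) := by
  unfold vnEntropy
  rw [dif_pos h]

lemma spectral_aux {ι : Type} [Fintype ι] [DecidableEq ι] (ρ : Matrix ι ι ℂ)
    (h : ρ.IsHermitian) : ∃ U : Matrix ι ι ℂ, U * Uᴴ = 1 ∧ Uᴴ * U = 1 ∧
      ρ = U * diagonal (fun i => (h.eigenvalues i : ℂ)) * Uᴴ := by
  refine ⟨h.eigenvectorUnitary, ?_, ?_, ?_⟩
  · exact Unitary.coe_mul_star_self h.eigenvectorUnitary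
  · exact Unitary.coe_star_mul_self h.eigenvectorUnitary
  · have := h.spectral_theorem
    rw [Unitary.conjStarAlgAut_apply] at this
    exact this

lemma sum_normSq_eq {ι κ : Type} [Fintype ι] [Fintype κ] (M : Matrix ι κ ℂ) :
    ((∑ i, ∑ k, Complex.normSq (M i k) : ℝ) : ℂ) = (M * Mᴴ).trace := by
  simp only [Matrix.trace, Matrix.diag, Matrix.mul_apply, Matrix.conjTranspose_apply]
  push_cast
  refine Finset.sum_congr rfl fun i _ => Finset.sum_congr rfl fun k _ => ?_
  rw [Complex.normSq_eq_conj_mul_self, mul_comm]; rfl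

lemma gibbs {ι κ : Type} [Fintype ι] [DecidableEq ι] [Fintype κ] [DecidableEq κ]
    (ρ : Matrix ι ι ℂ) (hρ : ρ.PosSemidef) (htr : ρ.trace = 1)
    (W : Matrix ι κ ℂ) (h1 : W * Wᴴ = 1) (h2 : Wᴴ * W = 1) (l : κ → ℝ)
    (hl : ∑ k, Real.exp (l k) ≤ 1) :
    vnEntropy ρ + (ρ * (W * diagonal (fun k => (l k : ℂ)) * Wᴴ)).trace.re ≤ 0 := by
  have hH := hρ.1
  rw [vnEntropy_eq ρ hH]
  obtain ⟨U, hU1, hU2, hU⟩ := spectral_aux ρ hH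
  have hnn : ∀ i, 0 ≤ hH.eigenvalues i := fun i => hρ.eigenvalues_nonneg i
  have hsum : ∑ i, hH.eigenvalues i = 1 := by
    have := hH.trace_eq_sum_eigenvalues
    rw [htr] at this
    exact Complex.ofReal_injective (by push_cast; exact this.symm)
  set lam := hH.eigenvalues with hlam
  set X : Matrix ι κ ℂ := Uᴴ * W with hX
  have hX1 : X * Xᴴ = 1 := by
    rw [hX, conjTranspose_mul, conjTranspose_conjTranspose, Matrix.mul_assoc,
      ← Matrix.mul_assoc W, h1, Matrix.one_mul, hU2]
  have hX2 : Xᴴ * X = 1 := by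
    rw [hX, conjTranspose_mul, conjTranspose_conjTranspose, Matrix.mul_assoc,
      ← Matrix.mul_assoc U, hU1, Matrix.one_mul, h2]
  have hr : ∀ i, ∑ k, Complex.normSq (X i k) = 1 := by
    intro i
    have := congrFun (congrFun hX1 i) i
    simp only [Matrix.mul_apply, Matrix.conjTranspose_apply, Matrix.one_apply_eq] at this
    have h3 : ((∑ k, Complex.normSq (X i k) : ℝ) : ℂ) = 1 := by
      rw [← this]; push_cast
      refine Finset.sum_congr rfl fun k _ => ?_
      rw [Complex.normSq_eq_conj_mul_self, mul_comm]; rfl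
    exact_mod_cast h3
  have hc : ∀ k, ∑ i, Complex.normSq (X i k) = 1 := by
    intro k
    have := congrFun (congrFun hX2 k) k
    simp only [Matrix.mul_apply, Matrix.conjTranspose_apply, Matrix.one_apply_eq] at this
    have h3 : ((∑ i, Complex.normSq (X i k) : ℝ) : ℂ) = 1 := by
      rw [← this]; push_cast
      refine Finset.sum_congr rfl fun k _ => ?_
      rw [Complex.normSq_eq_conj_mul_self]; rfl
    exact_mod_cast h3
  have htrace : (ρ * (W * diagonal (fun k => (l k : ℂ)) * Wᴴ)).trace
      = ((∑ i, ∑ k, lam i * Complex.normSq (X i k) * l k : ℝ) : ℂ) := by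
    have e1 : (ρ * (W * diagonal (fun k => (l k : ℂ)) * Wᴴ)).trace
        = ((diagonal (fun i => (lam i : ℂ))) * (X * diagonal (fun k => (l k : ℂ)) * Xᴴ)).trace := by
      conv_lhs => rw [hU]
      rw [Matrix.mul_assoc, Matrix.mul_assoc, Matrix.trace_mul_comm]
      rw [hX, conjTranspose_mul, conjTranspose_conjTranspose]
      simp only [Matrix.mul_assoc]
    rw [e1]
    simp only [Matrix.trace, Matrix.diag, Matrix.diagonal_mul]
    push_cast
    refine Finset.sum_congr rfl fun i _ => ?_
    rw [Matrix.mul_apply, Finset.mul_sum]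
    refine Finset.sum_congr rfl fun k _ => ?_
    rw [Matrix.mul_diagonal, Matrix.conjTranspose_apply, Complex.normSq_eq_conj_mul_self]
    simp only [RCLike.star_def]
    ring
  rw [htrace, Complex.ofReal_re]
  have key : ∀ i k, -(lam i * Real.log (lam i)) + lam i * l k ≤ Real.exp (l k) - lam i := by
    intro i k
    rcases (hnn i).eq_or_lt with h0 | h0
    · rw [← h0]; simp; positivity
    · have := Real.add_one_le_exp (l k - Real.log (lam i))
      rw [Real.exp_sub, Real.exp_log h0, le_div_iff₀ h0] at this
      linarith
  have e2 : -∑ i, lam i * Real.log (lam i)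
      = ∑ i, ∑ k, Complex.normSq (X i k) * (-(lam i * Real.log (lam i))) := by
    rw [← Finset.sum_neg_distrib]
    refine Finset.sum_congr rfl fun i _ => ?_
    rw [← Finset.sum_mul, hr, one_mul]
  rw [e2, ← Finset.sum_add_distrib]
  calc ∑ i, (∑ k, Complex.normSq (X i k) * (-(lam i * Real.log (lam i)))
        + ∑ k, lam i * Complex.normSq (X i k) * l k)
      = ∑ i, ∑ k, Complex.normSq (X i k) * (-(lam i * Real.log (lam i)) + lam i * l k) := by
        refine Finset.sum_congr rfl fun i _ => ?_
        rw [← Finset.sum_add_distrib]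
        refine Finset.sum_congr rfl fun k _ => ?_
        ring
    _ ≤ ∑ i, ∑ k, Complex.normSq (X i k) * (Real.exp (l k) - lam i) := by
        refine Finset.sum_le_sum fun i _ => Finset.sum_le_sum fun k _ => ?_
        exact mul_le_mul_of_nonneg_left (key i k) (Complex.normSq_nonneg _)
    _ = ∑ k, Real.exp (l k) * ∑ i, Complex.normSq (X i k)
        - ∑ i, lam i * ∑ k, Complex.normSq (X i k) := by
        simp only [mul_sub, Finset.sum_sub_distrib, Finset.mul_sum]
        rw [Finset.sum_comm]
        congr 1
        · refine Finset.sum_congr rfl fun i _ => Finset.sum_congr rfl fun k _ => by ring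
        · refine Finset.sum_congr rfl fun i _ => Finset.sum_congr rfl fun k _ => by ring
    _ ≤ 0 := by
        simp only [hr, hc, mul_one, hsum]; linarith

lemma entropy_lower {ι : Type} [Fintype ι] [DecidableEq ι] [Nonempty ι]
    (ρ : Matrix ι ι ℂ) (hρ : ρ.PosSemidef) (htr : ρ.trace = 1) :
    Real.log (Fintype.card ι) - (Fintype.card ι : ℝ) *
      ∑ a, ∑ a', Complex.normSq (ρ a a' - if a = a' then ((Fintype.card ι : ℂ))⁻¹ else 0)
      ≤ vnEntropy ρ := by
  have hH := hρ.1
  rw [vnEntropy_eq ρ hH]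
  obtain ⟨U, hU1, hU2, hU⟩ := spectral_aux ρ hH
  have hnn : ∀ i, 0 ≤ hH.eigenvalues i := fun i => hρ.eigenvalues_nonneg i
  have hsum : ∑ i, hH.eigenvalues i = 1 := by
    have := hH.trace_eq_sum_eigenvalues
    rw [htr] at this
    exact Complex.ofReal_injective (by push_cast; exact this.symm)
  set lam := hH.eigenvalues with hlam
  set D : ℝ := ((Fintype.card ι : ℕ) : ℝ) with hD
  have hDpos : 0 < D := by rw [hD]; exact_mod_cast Fintype.card_pos
  have e1 : ∑ a, ∑ a', Complex.normSq (ρ a a' - if a = a' then ((Fintype.card ι : ℂ))⁻¹ else 0)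
      = ∑ i, lam i ^ 2 - D⁻¹ := by
    have h3 := sum_normSq_eq (ρ - diagonal (fun _ => ((Fintype.card ι : ℂ))⁻¹))
    have h4 : (ρ - diagonal (fun _ => ((Fintype.card ι : ℂ))⁻¹))
        = U * diagonal (fun i => (lam i : ℂ) - ((Fintype.card ι : ℂ))⁻¹) * Uᴴ := by
      have : diagonal (fun _ : ι => ((Fintype.card ι : ℂ))⁻¹)
          = U * diagonal (fun _ : ι => ((Fintype.card ι : ℂ))⁻¹) * Uᴴ := by
        rw [← Matrix.smul_one_eq_diagonal]; simp [hU1]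
      conv_lhs => rw [this, hU]
      rw [← Matrix.sub_mul, ← Matrix.mul_sub, Matrix.diagonal_sub]
    have h5 : ((ρ - diagonal (fun _ => ((Fintype.card ι : ℂ))⁻¹)) *
        (ρ - diagonal (fun _ => ((Fintype.card ι : ℂ))⁻¹))ᴴ).trace
        = ((∑ i, (lam i - D⁻¹) ^ 2 : ℝ) : ℂ) := by
      rw [h4]
      simp only [conjTranspose_mul, conjTranspose_conjTranspose, diagonal_conjTranspose]
      rw [Matrix.mul_assoc U, Matrix.mul_assoc U, Matrix.trace_mul_comm]
      simp only [Matrix.mul_assoc, hU2, Matrix.mul_one]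
      rw [← Matrix.mul_assoc Uᴴ, hU2, Matrix.one_mul, Matrix.diagonal_mul_diagonal,
        Matrix.trace_diagonal]
      push_cast
      refine Finset.sum_congr rfl fun i _ => ?_
      simp [hD, sq]
    rw [h5] at h3
    have h6 := Complex.ofReal_injective h3
    have h7 : ∑ i, (lam i - D⁻¹) ^ 2 = ∑ i, lam i ^ 2 - D⁻¹ := by
      have : ∀ i, (lam i - D⁻¹) ^ 2 = lam i ^ 2 - 2 * D⁻¹ * lam i + D⁻¹ ^ 2 := fun i => by ring
      simp only [this, Finset.sum_add_distrib, Finset.sum_sub_distrib, ← Finset.mul_sum, hsum]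
      simp [← hD]
      field_simp
      ring
    rw [← h7, ← h6]
    rfl
  rw [e1]
  have key : ∀ i, Real.log D * lam i - D * lam i ^ 2 + lam i ≤ -(lam i * Real.log (lam i)) := by
    intro i
    rcases (hnn i).eq_or_lt with h0 | h0
    · rw [← h0]; simp
    · have := Real.log_le_sub_one_of_pos (mul_pos hDpos h0)
      rw [Real.log_mul hDpos.ne' h0.ne'] at this
      nlinarith
  have := Finset.sum_le_sum fun i (_ : i ∈ Finset.univ) => key i
  rw [Finset.sum_neg_distrib] at this
  simp only [Finset.sum_add_distrib, Finset.sum_sub_distrib, ← Finset.mul_sum, hsum] at this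
  have h8 : D * D⁻¹ = 1 := mul_inv_cancel₀ hDpos.ne'
  rw [mul_sub, h8]
  linarith

def joinEquiv (n m : ℕ) (hm : m ≤ n) :
    ((Fin m → Fin 2) × (Fin (n - m) → Fin 2)) ≃ (Fin n → Fin 2) where
  toFun p := joinCfg n m p.1 p.2
  invFun σ := (fun i => σ ⟨i, by omega⟩, fun i => σ ⟨(i : ℕ) + m, by omega⟩)
  left_inv p := by
    ext i
    · simp [joinCfg]
    · simp [joinCfg]
  right_inv σ := by
    ext i
    by_cases hi : (i : ℕ) < m
    · simp [joinCfg, hi]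
    · simp only [joinCfg, hi, dite_false]
      congr 3
      omega

lemma sum_join {α : Type} [AddCommMonoid α] (n m : ℕ) (hm : m ≤ n) (f : (Fin n → Fin 2) → α) :
    ∑ σ, f σ = ∑ a, ∑ b, f (joinCfg n m a b) := by
  rw [← (joinEquiv n m hm).sum_comp, Fintype.sum_prod_type]
  rfl

def embed (n m : ℕ) (hm : m ≤ n) (K : QOp m) : QOp n := fun σ τ =>
  if ((joinEquiv n m hm).symm σ).2 = ((joinEquiv n m hm).symm τ).2 then
    K ((joinEquiv n m hm).symm σ).1 ((joinEquiv n m hm).symm τ).1 else 0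

lemma embed_join (n m : ℕ) (hm : m ≤ n) (K : QOp m) (a b a' b') :
    embed n m hm K (joinCfg n m a b) (joinCfg n m a' b') = if b = b' then K a a' else 0 := by
  have h1 : ∀ a b, (joinEquiv n m hm).symm (joinCfg n m a b) = (a, b) := fun a b =>
    (joinEquiv n m hm).symm_apply_apply (a, b)
  simp only [embed, h1]

def ev {n : ℕ} (M : QOp n) (ψ : QState n) : ℂ :=
  ∑ σ, ∑ τ, (starRingEnd ℂ) (ψ σ) * M σ τ * ψ τ

lemma ev_embed (n m : ℕ) (hm : m ≤ n) (K : QOp m) (ψ : QState n) :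
    ev (embed n m hm K) ψ = (rdm n m ψ * K).trace := by
  unfold ev
  rw [sum_join n m hm]
  simp only [sum_join n m hm (fun τ => (starRingEnd ℂ) (ψ _) * embed n m hm K _ τ * ψ τ)]
  simp only [embed_join, Matrix.trace, Matrix.diag, Matrix.mul_apply, rdm]
  simp only [mul_ite, ite_mul, mul_zero, zero_mul, Finset.sum_ite_eq, Finset.mem_univ, if_true]
  conv_rhs => rw [Finset.sum_comm]
  refine Finset.sum_congr rfl fun a _ => ?_
  rw [Finset.sum_comm]
  refine Finset.sum_congr rfl fun a' _ => ?_
  rw [Finset.sum_mul]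
  refine Finset.sum_congr rfl fun b _ => ?_
  ring

lemma trace_embed_mul (n m : ℕ) (hm : m ≤ n) (K L : QOp m) :
    (embed n m hm K * embed n m hm L).trace = 2 ^ (n - m) * (K * L).trace := by
  simp only [Matrix.trace, Matrix.diag, Matrix.mul_apply]
  rw [sum_join n m hm]
  simp only [sum_join n m hm (fun τ => embed n m hm K _ τ * embed n m hm L τ _)]
  simp only [embed_join, mul_ite, ite_mul, mul_zero, zero_mul, Finset.sum_ite_eq,
    Finset.mem_univ, if_true]
  simp [Finset.mul_sum]

lemma twoSite_embed (n m : ℕ) (hm : m ≤ n) (h : Matrix (Fin 2 × Fin 2) (Fin 2 × Fin 2) ℂ)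
    (i : ℕ) (hi : i + 1 < m) :
    twoSite n h ⟨i, by omega⟩ = embed n m hm (twoSite m h ⟨i, by omega⟩) := by
  ext σ τ
  obtain ⟨⟨a, b⟩, rfl⟩ := (joinEquiv n m hm).surjective σ
  obtain ⟨⟨a', b'⟩, rfl⟩ := (joinEquiv n m hm).surjective τ
  change twoSite n h _ (joinCfg n m a b) (joinCfg n m a' b')
    = embed n m hm _ (joinCfg n m a b) (joinCfg n m a' b')
  rw [embed_join]
  have hs : (finSucc ⟨i, by omega⟩ : Fin n) = ⟨i + 1, by omega⟩ := by
    simp [finSucc, Nat.mod_eq_of_lt (show i + 1 < n by omega)]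
  have hs' : (finSucc ⟨i, by omega⟩ : Fin m) = ⟨i + 1, by omega⟩ := by
    simp [finSucc, Nat.mod_eq_of_lt hi]
  have hval : ∀ (a : Fin m → Fin 2) b (j : ℕ) (hj : j < m),
      joinCfg n m a b ⟨j, by omega⟩ = a ⟨j, hj⟩ := by
    intro a b j hj; simp [joinCfg, hj]
  have hval2 : ∀ (a : Fin m → Fin 2) b (j : Fin (n - m)),
      joinCfg n m a b ⟨j + m, by omega⟩ = b j := by
    intro a b j; simp [joinCfg]
  have hcond : (∀ j : Fin n, j ≠ ⟨i, by omega⟩ → j ≠ ⟨i + 1, by omega⟩ →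
      joinCfg n m a b j = joinCfg n m a' b' j) ↔
      (b = b' ∧ ∀ j : Fin m, j ≠ ⟨i, by omega⟩ → j ≠ ⟨i + 1, by omega⟩ → a j = a' j) := by
    constructor
    · intro H
      refine ⟨funext fun j => ?_, fun j h1 h2 => ?_⟩
      · have := H ⟨j + m, by omega⟩ (by simp [Fin.ext_iff]; omega) (by simp [Fin.ext_iff]; omega)
        rwa [hval2, hval2] at this
      · have := H ⟨j, by omega⟩ (by simpa [Fin.ext_iff] using h1) (by simpa [Fin.ext_iff] using h2)
        rwa [hval _ _ _ j.2, hval _ _ _ j.2] at this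
    · rintro ⟨rfl, H⟩ j h1 h2
      by_cases hj : (j : ℕ) < m
      · have := H ⟨j, hj⟩ (by simpa [Fin.ext_iff] using h1) (by simpa [Fin.ext_iff] using h2)
        simpa [joinCfg, hj] using this
      · simp [joinCfg, hj]
  unfold twoSite
  rw [hs, hs']
  simp only [hcond, hval _ _ i (by omega : i < m), hval _ _ (i+1) hi]
  by_cases hb : b = b' <;> simp [hb]

lemma rdm_posSemidef (n m : ℕ) (ψ : QState n) : (rdm n m ψ).PosSemidef := by
  have : rdm n m ψ = (Matrix.of fun a b => ψ (joinCfg n m a b)) *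
      (Matrix.of fun a b => ψ (joinCfg n m a b))ᴴ := by
    ext a a'
    simp [rdm, Matrix.mul_apply]
  rw [this]
  exact Matrix.posSemidef_self_mul_conjTranspose _

lemma rdm_trace (n m : ℕ) (hm : m ≤ n) (ψ : QState n)
    (hψ : ∑ σ, (starRingEnd ℂ) (ψ σ) * ψ σ = 1) : (rdm n m ψ).trace = 1 := by
  rw [← hψ, sum_join n m hm]
  simp only [Matrix.trace, Matrix.diag, rdm]
  refine Finset.sum_congr rfl fun a _ => Finset.sum_congr rfl fun b _ => mul_comm _ _

lemma finSucc_inj {n : ℕ} : Function.Injective (finSucc : Fin n → Fin n) := by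
  intro i j hij
  simp only [finSucc, Fin.mk.injEq] at hij
  have := i.2; have := j.2
  ext
  have h1 : ((i : ℕ) + 1) ≡ (j + 1) [MOD n] := hij
  exact Nat.ModEq.eq_of_lt_of_lt (Nat.ModEq.add_right_cancel' 1 h1) i.2 j.2

lemma finSucc_bij {n : ℕ} : Function.Bijective (finSucc : Fin n → Fin n) :=
  Finite.injective_iff_bijective.1 finSucc_inj

lemma shiftCfg_bij {n : ℕ} : Function.Bijective (shiftCfg : (Fin n → Fin 2) → (Fin n → Fin 2)) := by
  refine Finite.injective_iff_bijective.1 fun σ τ hst => funext fun i => ?_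
  obtain ⟨j, rfl⟩ := finSucc_bij.2 i
  exact congrFun hst j

lemma ev_shift {n : ℕ} (M : QOp n) (ψ : QState n)
    (hψ : ∑ σ, (starRingEnd ℂ) (ψ σ) * ψ σ = 1)
    (hc : ∃ c : ℂ, ∀ σ, ψ (shiftCfg σ) = c * ψ σ) :
    ev (M.submatrix shiftCfg shiftCfg) ψ = ev M ψ := by
  obtain ⟨c, hc⟩ := hc
  have hs : ∀ f : (Fin n → Fin 2) → ℂ, ∑ σ, f (shiftCfg σ) = ∑ σ, f σ := fun f =>
    Function.Bijective.sum_comp shiftCfg_bij f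
  have h1 : (starRingEnd ℂ) c * c = 1 := by
    have := hs (fun σ => (starRingEnd ℂ) (ψ σ) * ψ σ)
    rw [hψ] at this
    simp only [hc, map_mul] at this
    rw [← this, ← mul_one ((starRingEnd ℂ) c * c), ← hψ, Finset.mul_sum]
    refine Finset.sum_congr rfl fun σ _ => by ring
  unfold ev
  conv_rhs => rw [← hs]
  refine Finset.sum_congr rfl fun σ _ => ?_
  conv_rhs => rw [← hs]
  refine Finset.sum_congr rfl fun τ _ => ?_
  simp only [hc, map_mul, Matrix.submatrix_apply]
  linear_combination (-(starRingEnd ℂ) (ψ σ) * M (shiftCfg σ) (shiftCfg τ) * ψ τ) * h1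

lemma ev_shift_iter {n : ℕ} (M : QOp n) (ψ : QState n)
    (hψ : ∑ σ, (starRingEnd ℂ) (ψ σ) * ψ σ = 1)
    (hc : ∃ c : ℂ, ∀ σ, ψ (shiftCfg σ) = c * ψ σ) (k : ℕ) :
    ev (M.submatrix (shiftCfg^[k]) (shiftCfg^[k])) ψ = ev M ψ := by
  induction k with
  | zero => rfl
  | succ k ih =>
    rw [← ih, ← ev_shift (M.submatrix (shiftCfg^[k]) (shiftCfg^[k])) ψ hψ hc]
    rfl

lemma twoSite_shift {n : ℕ} (h : Matrix (Fin 2 × Fin 2) (Fin 2 × Fin 2) ℂ) (i : Fin n) :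
    twoSite n h (finSucc i) = (twoSite n h i).submatrix shiftCfg shiftCfg := by
  ext σ τ
  simp only [Matrix.submatrix_apply, twoSite, shiftCfg]
  have : (∀ j : Fin n, j ≠ finSucc i → j ≠ finSucc (finSucc i) → σ j = τ j) ↔
      ∀ j : Fin n, j ≠ i → j ≠ finSucc i → σ (finSucc j) = τ (finSucc j) := by
    rw [finSucc_bij.2.forall]
    simp only [ne_eq, finSucc_inj.eq_iff]
  exact if_congr this rfl rfl

lemma ev_twoSite {n : ℕ} (h : Matrix (Fin 2 × Fin 2) (Fin 2 × Fin 2) ℂ) (ψ : QState n)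
    (hψ : ∑ σ, (starRingEnd ℂ) (ψ σ) * ψ σ = 1)
    (hc : ∃ c : ℂ, ∀ σ, ψ (shiftCfg σ) = c * ψ σ) (i : ℕ) (hi : i < n) :
    ev (twoSite n h ⟨i, hi⟩) ψ = ev (twoSite n h ⟨0, by omega⟩) ψ := by
  induction i with
  | zero => rfl
  | succ k ih =>
    rw [← ih (by omega), ← ev_shift (twoSite n h ⟨k, by omega⟩) ψ hψ hc, ← twoSite_shift]
    congr 2
    simp [finSucc, Nat.mod_eq_of_lt hi]

lemma ev_eigen {n : ℕ} (h : Matrix (Fin 2 × Fin 2) (Fin 2 × Fin 2) ℂ) (ψ : QState n)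
    (hψ : ∑ σ, (starRingEnd ℂ) (ψ σ) * ψ σ = 1)
    (hc : ∃ c : ℂ, ∀ σ, ψ (shiftCfg σ) = c * ψ σ) (E : ℝ)
    (hE : (∑ i, twoSite n h i).mulVec ψ = (E : ℂ) • ψ) (i : ℕ) (hi : i < n) :
    ev (twoSite n h ⟨i, hi⟩) ψ = ((E / n : ℝ) : ℂ) := by
  have h1 : ev (∑ i, twoSite n h i) ψ = E := by
    have : ev (∑ i, twoSite n h i) ψ
        = ∑ σ, (starRingEnd ℂ) (ψ σ) * ((∑ i, twoSite n h i).mulVec ψ) σ := by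
      unfold ev Matrix.mulVec dotProduct
      simp only [Finset.mul_sum, mul_assoc]
    have h0 : (E : ℂ) = E * ∑ σ, (starRingEnd ℂ) (ψ σ) * ψ σ := by rw [hψ, mul_one]
    rw [this, hE, h0, Finset.mul_sum]
    refine Finset.sum_congr rfl fun σ _ => ?_
    simp only [Pi.smul_apply, smul_eq_mul]
    rw [← Finset.mul_sum, hψ]; ring
  have h2 : ev (∑ i, twoSite n h i) ψ = ∑ i, ev (twoSite n h i) ψ := by
    unfold ev
    simp only [Matrix.sum_apply, Finset.mul_sum, Finset.sum_mul]
    conv_rhs => rw [Finset.sum_comm]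
    refine Finset.sum_congr rfl fun σ _ => ?_
    rw [Finset.sum_comm]
  have h3 : ∀ j : Fin n, ev (twoSite n h j) ψ = ev (twoSite n h ⟨i, hi⟩) ψ := fun j => by
    rw [ev_twoSite h ψ hψ hc i hi, ← ev_twoSite h ψ hψ hc j j.2]
  rw [h2, Finset.sum_congr rfl fun j _ => h3 j] at h1
  simp at h1
  have hn : (n : ℂ) ≠ 0 := by
    have : n ≠ 0 := by omega
    exact_mod_cast this
  push_cast
  rw [eq_div_iff hn, mul_comm, h1]

lemma eig_bound (n : ℕ) (hn : 2 ≤ n) (h : Matrix (Fin 2 × Fin 2) (Fin 2 × Fin 2) ℂ)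
    (hh : h.IsHermitian) (hnorm : opNorm (twoSite n h ⟨0, by omega⟩) = 1) (x : Fin 2 × Fin 2) :
    |hh.eigenvalues x| ≤ 1 := by
  set w : Fin 2 × Fin 2 → ℂ := (hh.eigenvectorBasis x).ofLp with hw
  have hwe : h *ᵥ w = hh.eigenvalues x • w := hh.mulVec_eigenvectorBasis x
  set φ : QState n := fun σ => w (σ ⟨0, by omega⟩, σ ⟨1, by omega⟩) with hφ
  have hφj : ∀ a b, φ (joinCfg n 2 a b) = w (a 0, a 1) := by
    intro a b; simp [hφ, joinCfg]
  have hK : ∀ a a', twoSite 2 h ⟨0, by omega⟩ a a' = h (a 0, a 1) (a' 0, a' 1) := by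
    intro a a'
    unfold twoSite
    rw [if_pos]
    · rfl
    · intro j h1 h2
      exfalso
      fin_cases j
      · exact h1 rfl
      · exact h2 rfl
  have hM : twoSite n h ⟨0, by omega⟩ *ᵥ φ = (hh.eigenvalues x : ℂ) • φ := by
    rw [twoSite_embed n 2 hn h 0 (by omega)]
    ext σ
    obtain ⟨⟨a, b⟩, rfl⟩ := (joinEquiv n 2 hn).surjective σ
    change (_ *ᵥ φ) (joinCfg n 2 a b) = ((hh.eigenvalues x : ℂ) • φ) (joinCfg n 2 a b)
    simp only [Matrix.mulVec, dotProduct, Pi.smul_apply]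
    rw [sum_join n 2 hn]
    simp only [embed_join, hφj, hK, ite_mul, zero_mul, Finset.sum_ite_eq, Finset.mem_univ, if_true]
    have := congrFun hwe (a 0, a 1)
    simp only [Matrix.mulVec, dotProduct, Pi.smul_apply] at this
    rw [← (finTwoArrowEquiv (Fin 2)).sum_comp] at this
    simpa using this
  have hφ0 : φ ≠ 0 := by
    intro h0
    have hw0 : w = 0 := by
      ext ⟨y, z⟩
      have := congrFun h0 (joinCfg n 2 ![y, z] (fun _ => 0))
      rw [hφj] at this
      simpa using this
    have h1 := hh.eigenvectorBasis.orthonormal.1 x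
    have h2 : hh.eigenvectorBasis x = 0 := by
      ext y
      exact congrFun hw0 y
    rw [h2] at h1
    simp at h1
  have hle := (LinearMap.toContinuousLinearMap
    (Matrix.toEuclideanLin (twoSite n h ⟨0, by omega⟩))).le_opNorm (WithLp.toLp 2 φ)
  unfold opNorm at hnorm
  rw [hnorm, one_mul] at hle
  have h3 : (LinearMap.toContinuousLinearMap
    (Matrix.toEuclideanLin (twoSite n h ⟨0, by omega⟩))) (WithLp.toLp 2 φ)
     = (hh.eigenvalues x : ℂ) • WithLp.toLp 2 φ := by
    rw [LinearMap.coe_toContinuousLinearMap', Matrix.toLpLin_toLp, Matrix.toLin'_apply, hM]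
    rfl
  rw [h3, norm_smul] at hle
  have hpos : 0 < ‖WithLp.toLp 2 φ‖ := by
    rw [norm_pos_iff]
    intro h0
    apply hφ0
    exact congrArg WithLp.ofLp h0
  have h6 : ‖(hh.eigenvalues x : ℂ)‖ ≤ 1 := le_of_mul_le_mul_right (by rwa [one_mul]) hpos
  simpa using h6

def pr (r : ℕ) (p : Fin r) (a : Fin (r + r) → Fin 2) : Fin 2 × Fin 2 :=
  (a ⟨2 * p, by omega⟩, a ⟨2 * p + 1, by omega⟩)

lemma pr_eq_iff (r : ℕ) (a a' : Fin (r + r) → Fin 2) (p : Fin r) :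
    pr r p a = pr r p a' ↔
      a ⟨2 * p, by omega⟩ = a' ⟨2 * p, by omega⟩ ∧ a ⟨2 * p + 1, by omega⟩ = a' ⟨2 * p + 1, by omega⟩ := by
  simp [pr]

def prodU (r : ℕ) (U : Matrix (Fin 2 × Fin 2) (Fin 2 × Fin 2) ℂ) :
    Matrix (Fin (r + r) → Fin 2) (Fin r → Fin 2 × Fin 2) ℂ :=
  fun a k => ∏ p, U (pr r p a) (k p)

lemma prodU_gen (r : ℕ) (U : Matrix (Fin 2 × Fin 2) (Fin 2 × Fin 2) ℂ)
    (g : Fin r → Fin 2 × Fin 2 → ℂ) :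
    prodU r U * diagonal (fun k : Fin r → Fin 2 × Fin 2 => ∏ p, g p (k p)) * (prodU r U)ᴴ
      = Matrix.of fun a a' => ∏ p, (U * diagonal (g p) * Uᴴ) (pr r p a) (pr r p a') := by
  ext a a'
  rw [Matrix.mul_apply, Matrix.of_apply]
  simp only [Matrix.mul_diagonal, Matrix.conjTranspose_apply]
  simp only [Matrix.mul_apply (M := U * diagonal _), Matrix.mul_diagonal,
    Matrix.conjTranspose_apply]
  rw [Fintype.prod_sum]
  refine Finset.sum_congr rfl fun k _ => ?_
  simp only [prodU, star_prod, Finset.prod_mul_distrib]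

lemma prodU_one (r : ℕ) (U : Matrix (Fin 2 × Fin 2) (Fin 2 × Fin 2) ℂ) (hU : U * Uᴴ = 1) :
    prodU r U * (prodU r U)ᴴ = 1 := by
  have := prodU_gen r U (fun _ _ => 1)
  simp only [Finset.prod_const_one, Matrix.diagonal_one, Matrix.mul_one, hU] at this
  rw [this]
  ext a a'
  by_cases haa : a = a'
  · subst haa; simp
  · rw [Matrix.one_apply_ne haa]
    obtain ⟨i, hi⟩ := Function.ne_iff.1 haa
    apply Finset.prod_eq_zero (Finset.mem_univ (⟨i / 2, by omega⟩ : Fin r))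
    apply Matrix.one_apply_ne
    intro h1
    rw [pr_eq_iff] at h1
    apply hi
    rcases Nat.even_or_odd' (i : ℕ) with ⟨c, hc | hc⟩
    · have : i = ⟨2 * ((i : ℕ) / 2), by omega⟩ := by ext; simp; omega
      rw [this]; exact h1.1
    · have : i = ⟨2 * ((i : ℕ) / 2) + 1, by omega⟩ := by ext; simp; omega
      rw [this]; exact h1.2

lemma prodU_one' (r : ℕ) (U : Matrix (Fin 2 × Fin 2) (Fin 2 × Fin 2) ℂ) (hU : U * Uᴴ = 1) :
    (prodU r U)ᴴ * prodU r U = 1 := by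
  have e : (Fin (r + r) → Fin 2) ≃ (Fin r → Fin 2 × Fin 2) :=
    Fintype.equivOfCardEq (by simp [← two_mul, pow_mul])
  exact (Matrix.mul_eq_one_comm_of_equiv e).1 (prodU_one r U hU)

lemma prodU_twoSite (r : ℕ) (h U : Matrix (Fin 2 × Fin 2) (Fin 2 × Fin 2) ℂ) (hU : U * Uᴴ = 1)
    (ε : Fin 2 × Fin 2 → ℝ) (hh : h = U * diagonal (fun x => (ε x : ℂ)) * Uᴴ) (p : Fin r) :
    prodU r U * diagonal (fun k : Fin r → Fin 2 × Fin 2 => (ε (k p) : ℂ)) * (prodU r U)ᴴ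
      = twoSite (r + r) h ⟨2 * p, by omega⟩ := by
  have h1 : (fun k : Fin r → Fin 2 × Fin 2 => (ε (k p) : ℂ))
      = fun k => ∏ p', (fun p' x => if p' = p then (ε x : ℂ) else 1) p' (k p') := by
    ext k
    rw [Finset.prod_ite_eq' Finset.univ p (fun p' => (ε (k p') : ℂ))]
    simp
  rw [h1, prodU_gen r U (fun p' x => if p' = p then (ε x : ℂ) else 1)]
  ext a a'
  have hs : (finSucc ⟨2 * p, by omega⟩ : Fin (r + r)) = ⟨2 * p + 1, by omega⟩ := by
    simp [finSucc, Nat.mod_eq_of_lt (show 2 * (p : ℕ) + 1 < r + r by omega)]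
  unfold twoSite
  rw [hs]
  have h2 : ∀ p', (U * diagonal (fun x => if p' = p then (ε x : ℂ) else 1) * Uᴴ)
      (pr r p' a) (pr r p' a') = if p' = p then h (pr r p' a) (pr r p' a') else
        if pr r p' a = pr r p' a' then 1 else 0 := by
    intro p'
    by_cases hp : p' = p
    · simp only [hp, if_true, ← hh]
    · simp only [hp, if_false, Matrix.diagonal_one, Matrix.mul_one, hU, Matrix.one_apply]
  rw [Matrix.of_apply, Finset.prod_congr rfl fun p' _ => h2 p']
  split_ifs with hc
  · rw [Finset.prod_eq_single p]
    · simp [pr]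
    · intro p' _ hp
      rw [if_neg hp, if_pos]
      rw [pr_eq_iff]
      have hp' : (p' : ℕ) ≠ p := fun hh => hp (Fin.ext hh)
      constructor
      · apply hc <;> simp [Fin.ext_iff] <;> omega
      · apply hc <;> simp [Fin.ext_iff] <;> omega
    · simp
  · push Not at hc
    obtain ⟨i, h3, h4, h5⟩ := hc
    simp only [ne_eq, Fin.ext_iff] at h3 h4
    apply Finset.prod_eq_zero (Finset.mem_univ (⟨i / 2, by omega⟩ : Fin r))
    rw [if_neg (by simp [Fin.ext_iff]; omega), if_neg]
    intro h1
    rw [pr_eq_iff] at h1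
    apply h5
    rcases Nat.even_or_odd' (i : ℕ) with ⟨c, hc | hc⟩
    · have : i = ⟨2 * ((i : ℕ) / 2), by omega⟩ := by ext; simp; omega
      rw [this]; exact h1.1
    · have : i = ⟨2 * ((i : ℕ) / 2) + 1, by omega⟩ := by ext; simp; omega
      rw [this]; exact h1.2

lemma exp_le_chord (t x : ℝ) (hx : |x| ≤ 1) :
    Real.exp (t * x) ≤ Real.cosh t + x * Real.sinh t := by
  obtain ⟨h1, h2⟩ := abs_le.1 hx
  have := convexOn_exp.2 (Set.mem_univ t) (Set.mem_univ (-t)) (show 0 ≤ (1 + x) / 2 by linarith)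
    (show 0 ≤ (1 - x) / 2 by linarith) (by ring)
  simp only [smul_eq_mul] at this
  have e : (1 + x) / 2 * t + (1 - x) / 2 * -t = t * x := by ring
  rw [e] at this
  rw [Real.cosh_eq, Real.sinh_eq]
  linarith

lemma log_Z_le (ε : Fin 2 × Fin 2 → ℝ) (hb : ∀ x, |ε x| ≤ 1) (h0 : ∑ x, ε x = 0) (t : ℝ) :
    Real.log (∑ x, Real.exp (t * ε x)) ≤ 2 * Real.log 2 + t ^ 2 / 2 := by
  have h1 : ∑ x, Real.exp (t * ε x) ≤ 4 * Real.exp (t ^ 2 / 2) := by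
    calc _ ≤ ∑ x, (Real.cosh t + ε x * Real.sinh t) :=
          Finset.sum_le_sum fun x _ => exp_le_chord t _ (hb x)
      _ = 4 * Real.cosh t := by
          rw [Finset.sum_add_distrib, ← Finset.sum_mul, h0]
          simp
      _ ≤ _ := by linarith [Real.cosh_le_exp_half_sq t]
  have hp : 0 < ∑ x, Real.exp (t * ε x) :=
    Finset.sum_pos (fun x _ => Real.exp_pos _) Finset.univ_nonempty
  have := Real.log_le_log hp h1
  rw [Real.log_mul (by norm_num) (Real.exp_pos _).ne', Real.log_exp] at this
  have h4 : Real.log 4 = 2 * Real.log 2 := by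
    rw [show (4 : ℝ) = 2 ^ 2 by norm_num, Real.log_pow]; norm_num
  linarith

lemma upper_state (n r : ℕ) (hr : r + r ≤ n)
    (h : Matrix (Fin 2 × Fin 2) (Fin 2 × Fin 2) ℂ) (hh : h.IsHermitian) (htr : h.trace = 0)
    (hb : ∀ x, |hh.eigenvalues x| ≤ 1) (ψ : QState n)
    (hψ : ∑ σ, (starRingEnd ℂ) (ψ σ) * ψ σ = 1) (t : ℝ)
    (hev : ∀ i, ∀ hi : i < n, ev (twoSite n h ⟨i, hi⟩) ψ = (t : ℂ)) :
    entEntropy n (r + r) ψ ≤ ((r + r : ℕ) : ℝ) * Real.log 2 - ((r + r : ℕ) : ℝ) * t ^ 2 / 4 := by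
  obtain ⟨U, hU1, hU2, hU⟩ := spectral_aux h hh
  set ε := hh.eigenvalues with hε
  have h0 : ∑ x, ε x = 0 := by
    have := hh.trace_eq_sum_eigenvalues
    rw [htr] at this
    exact Complex.ofReal_injective (by push_cast; exact this.symm)
  set Z := ∑ x, Real.exp (t * ε x) with hZ
  have hp : 0 < Z :=
    Finset.sum_pos (fun x _ => Real.exp_pos _) Finset.univ_nonempty
  have hlog := log_Z_le ε hb h0 t
  have hg := gibbs (rdm n (r + r) ψ) (rdm_posSemidef _ _ _) (rdm_trace _ _ hr ψ hψ)
    (prodU r U) (prodU_one r U hU1) (prodU_one' r U hU1)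
    (fun k => ∑ p, (t * ε (k p) - Real.log Z)) (by
      have : ∀ k : Fin r → Fin 2 × Fin 2, Real.exp (∑ p, (t * ε (k p) - Real.log Z))
          = ∏ p, (Real.exp (t * ε (k p)) / Z) := by
        intro k
        rw [Real.exp_sum]
        refine Finset.prod_congr rfl fun p _ => ?_
        rw [Real.exp_sub, Real.exp_log hp]
      simp only [this]
      rw [← Fintype.prod_sum (fun (_ : Fin r) x => Real.exp (t * ε x) / Z)]
      simp only [← Finset.sum_div, ← hZ, div_self hp.ne']
      simp)
  have hL : prodU r U * diagonal (fun k : Fin r → Fin 2 × Fin 2 =>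
      ((∑ p, (t * ε (k p) - Real.log Z) : ℝ) : ℂ)) * (prodU r U)ᴴ
      = (t : ℂ) • (∑ p : Fin r, twoSite (r + r) h ⟨2 * p, by omega⟩)
        - ((r * Real.log Z : ℝ) : ℂ) • (1 : QOp (r + r)) := by
    have hd : diagonal (fun k : Fin r → Fin 2 × Fin 2 =>
      ((∑ p, (t * ε (k p) - Real.log Z) : ℝ) : ℂ))
       = (t : ℂ) • (∑ p : Fin r, diagonal (fun k : Fin r → Fin 2 × Fin 2 => (ε (k p) : ℂ)))
        - ((r * Real.log Z : ℝ) : ℂ) • 1 := by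
      ext k k'
      by_cases hk : k = k'
      · subst hk
        simp [Matrix.sum_apply, Finset.mul_sum]
      · simp [Matrix.sum_apply, hk]
    rw [hd, Matrix.mul_sub, Matrix.sub_mul]
    simp only [Matrix.mul_smul, Matrix.smul_mul, Matrix.mul_one, prodU_one r U hU1]
    congr 2
    rw [Matrix.mul_sum, Matrix.sum_mul]
    refine Finset.sum_congr rfl fun p _ => ?_
    exact prodU_twoSite r h U hU1 ε hU p
  rw [hL] at hg
  have hT : (rdm n (r + r) ψ * ((t : ℂ) • (∑ p : Fin r, twoSite (r + r) h ⟨2 * p, by omega⟩)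
        - ((r * Real.log Z : ℝ) : ℂ) • (1 : QOp (r + r)))).trace
        = ((r * t ^ 2 - r * Real.log Z : ℝ) : ℂ) := by
    rw [Matrix.mul_sub, Matrix.trace_sub, Matrix.mul_smul, Matrix.mul_smul, Matrix.trace_smul,
      Matrix.trace_smul, Matrix.mul_one, rdm_trace _ _ hr ψ hψ, Matrix.mul_sum, Matrix.trace_sum]
    have : ∀ p : Fin r, (rdm n (r + r) ψ * twoSite (r + r) h ⟨2 * p, by omega⟩).trace = (t : ℂ) := by
      intro p
      rw [← ev_embed n (r + r) hr, ← twoSite_embed n (r + r) hr h (2 * p) (by omega)]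
      exact hev _ _
    simp only [this]
    simp
    ring
  rw [hT, Complex.ofReal_re] at hg
  unfold entEntropy
  have hr0 : (0 : ℝ) ≤ r := Nat.cast_nonneg r
  have := mul_le_mul_of_nonneg_left hlog hr0
  push_cast
  linarith

section basis
variable {n : ℕ}

lemma basis_unitary (v : (Fin n → Fin 2) → QState n)
    (hv : ∀ j j', ∑ σ, (starRingEnd ℂ) (v j σ) * v j' σ = if j = j' then 1 else 0) :
    (Matrix.of fun σ j => v j σ)ᴴ * (Matrix.of fun σ j => v j σ) = (1 : QOp n) ∧
    (Matrix.of fun σ j => v j σ) * (Matrix.of fun σ j => v j σ)ᴴ = (1 : QOp n) := by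
  have h1 : (Matrix.of fun σ j => v j σ)ᴴ * (Matrix.of fun σ j => v j σ) = (1 : QOp n) := by
    ext j j'
    rw [Matrix.mul_apply, Matrix.one_apply, ← hv j j']
    rfl
  exact ⟨h1, mul_eq_one_comm.1 h1⟩

lemma diag_sum_le (v : (Fin n → Fin 2) → QState n)
    (hv : ∀ j j', ∑ σ, (starRingEnd ℂ) (v j σ) * v j' σ = if j = j' then 1 else 0) (M : QOp n) :
    ∑ j, Complex.normSq (ev M (v j)) ≤ ∑ σ, ∑ τ, Complex.normSq (M σ τ) := by
  obtain ⟨h1, h2⟩ := basis_unitary v hv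
  set V : QOp n := Matrix.of fun σ j => v j σ with hV
  have h3 : ∀ j, ev M (v j) = (Vᴴ * M * V) j j := by
    intro j
    rw [Matrix.mul_apply]
    unfold ev
    rw [Finset.sum_comm]
    refine Finset.sum_congr rfl fun τ _ => ?_
    rw [Matrix.mul_apply, Finset.sum_mul]
    rfl
  have h4 : ∑ σ, ∑ τ, Complex.normSq (M σ τ)
      = ∑ i, ∑ j, Complex.normSq ((Vᴴ * M * V) i j) := by
    apply Complex.ofReal_injective
    rw [sum_normSq_eq, sum_normSq_eq]
    have : (Vᴴ * M * V) * (Vᴴ * M * V)ᴴ = Vᴴ * (M * Mᴴ * V) := by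
      simp only [conjTranspose_mul, conjTranspose_conjTranspose, Matrix.mul_assoc]
      rw [← Matrix.mul_assoc V Vᴴ, h2, Matrix.one_mul]
    rw [this, Matrix.trace_mul_comm Vᴴ, Matrix.mul_assoc, h2, Matrix.mul_one]
  rw [h4]
  refine Finset.sum_le_sum fun j _ => ?_
  rw [h3]
  exact Finset.single_le_sum (f := fun i => Complex.normSq ((Vᴴ * M * V) j i))
    (fun i _ => Complex.normSq_nonneg _) (Finset.mem_univ j)

lemma energy_sum (v : (Fin n → Fin 2) → QState n) (E : (Fin n → Fin 2) → ℝ)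
    (hv : ∀ j j', ∑ σ, (starRingEnd ℂ) (v j σ) * v j' σ = if j = j' then 1 else 0) (H : QOp n)
    (hE : ∀ j, H.mulVec (v j) = (E j : ℂ) • v j) :
    ((∑ j, E j ^ 2 : ℝ) : ℂ) = (H * H).trace := by
  obtain ⟨h1, h2⟩ := basis_unitary v hv
  set V : QOp n := Matrix.of fun σ j => v j σ with hV
  have h3 : H * V = V * diagonal (fun j => (E j : ℂ)) := by
    ext σ j
    have := congrFun (hE j) σ
    rw [Matrix.mul_diagonal]
    rw [Matrix.mul_apply]
    simp only [Matrix.mulVec, dotProduct, Pi.smul_apply, smul_eq_mul] at this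
    rw [mul_comm] at this
    exact this
  have h4 : (H * H).trace = (H * V * (Vᴴ * H)).trace := by
    rw [Matrix.mul_assoc H V, ← Matrix.mul_assoc V, h2, Matrix.one_mul]
  rw [h4, Matrix.trace_mul_comm, Matrix.mul_assoc Vᴴ, h3, ← Matrix.mul_assoc H, h3]
  rw [← Matrix.mul_assoc, ← Matrix.mul_assoc, h1, Matrix.one_mul, Matrix.diagonal_mul_diagonal,
    Matrix.trace_diagonal]
  push_cast
  refine Finset.sum_congr rfl fun j _ => sq _

end basis

lemma shift_iter {n : ℕ} (t : ℕ) (σ : Fin n → Fin 2) (i : Fin n) :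
    (shiftCfg^[t] σ) i = σ ⟨((i : ℕ) + t) % n, Nat.mod_lt _ i.pos⟩ := by
  induction t generalizing i σ with
  | zero => simp [Nat.mod_eq_of_lt i.2]
  | succ t ih =>
    rw [Function.iterate_succ_apply, ih]
    simp only [shiftCfg, finSucc]
    congr 2
    rw [Nat.mod_add_mod]; ring_nf

lemma embed_shift (n m : ℕ) (hm : m ≤ n) (K : QOp m) (t : ℕ) (h1 : m ≤ t) (h2 : t + m ≤ n)
    (a a' : Fin m → Fin 2) (b : Fin (n - m) → Fin 2) :
    embed n m hm K (shiftCfg^[t] (joinCfg n m a b)) (shiftCfg^[t] (joinCfg n m a' b))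
      = if a = a' then K (fun i : Fin m => b ⟨(i : ℕ) + t - m, by omega⟩)
          (fun i : Fin m => b ⟨(i : ℕ) + t - m, by omega⟩)
        else 0 := by
  have hA : ∀ a : Fin m → Fin 2, ((joinEquiv n m hm).symm (shiftCfg^[t] (joinCfg n m a b))).1
      = fun i : Fin m => b ⟨(i : ℕ) + t - m, by omega⟩ := by
    intro a
    ext i
    change ((shiftCfg^[t] (joinCfg n m a b)) ⟨i, by omega⟩ : ℕ) = _
    rw [shift_iter]
    have : ((i : ℕ) + t) % n = i + t := Nat.mod_eq_of_lt (by omega)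
    simp only [this, joinCfg]
    rw [dif_neg (by omega)]
  unfold embed
  rw [hA, hA]
  by_cases haa : a = a'
  · subst haa; simp
  · rw [if_neg haa, if_neg]
    intro heq
    apply haa
    ext i
    have := congrFun heq ⟨i + n - t - m, by omega⟩
    change (shiftCfg^[t] (joinCfg n m a b)) ⟨(i + n - t - m) + m, _⟩
      = (shiftCfg^[t] (joinCfg n m a' b)) ⟨(i + n - t - m) + m, _⟩ at this
    rw [shift_iter, shift_iter] at this
    have hmod : ((i : ℕ) + n - t - m + m + t) % n = i := by
      have : (i : ℕ) + n - t - m + m + t = i + n := by omega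
      rw [this, Nat.add_mod_right, Nat.mod_eq_of_lt (by omega)]
    simp only [hmod, joinCfg] at this
    simpa using congrArg Fin.val this

lemma cross_zero (n m : ℕ) (hm : m ≤ n) (K : QOp m) (hK : K.trace = 0) (t : ℕ)
    (h1 : m ≤ t) (h2 : t + m ≤ n) :
    ∑ σ, ∑ τ, (starRingEnd ℂ) (embed n m hm K σ τ) *
      embed n m hm K (shiftCfg^[t] σ) (shiftCfg^[t] τ) = 0 := by
  rw [sum_join n m hm]
  simp only [sum_join n m hm (fun τ => (starRingEnd ℂ) (embed n m hm K _ τ) *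
      embed n m hm K _ (shiftCfg^[t] τ))]
  simp only [embed_join, apply_ite (starRingEnd ℂ), map_zero, ite_mul, zero_mul,
    Finset.sum_ite_eq, Finset.mem_univ, if_true]
  simp only [embed_shift n m hm K t h1 h2, mul_ite, mul_zero, Finset.sum_ite_eq,
    Finset.mem_univ, if_true]
  rw [Finset.sum_comm]
  refine Finset.sum_eq_zero fun b _ => ?_
  rw [← Finset.sum_mul, ← map_sum]
  have : ∑ x, K x x = 0 := hK
  rw [this]; simp

lemma shift_iter_bij {n : ℕ} (k : ℕ) :
    Function.Bijective (shiftCfg^[k] : (Fin n → Fin 2) → (Fin n → Fin 2)) :=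
  shiftCfg_bij.iterate k

lemma cross_zero' (n m : ℕ) (hm : m ≤ n) (K : QOp m) (hK : K.trace = 0) (k l : ℕ)
    (hkl : k < l) (hl : m * l + m ≤ n) :
    ∑ σ, ∑ τ, (starRingEnd ℂ) (embed n m hm K (shiftCfg^[m * k] σ) (shiftCfg^[m * k] τ)) *
      embed n m hm K (shiftCfg^[m * l] σ) (shiftCfg^[m * l] τ) = 0 := by
  obtain ⟨d, rfl⟩ := Nat.exists_eq_add_of_lt hkl
  have e : m * (k + d + 1) = m * (d + 1) + m * k := by ring
  have h := cross_zero n m hm K hK (m * (d + 1)) (by nlinarith) (by nlinarith)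
  rw [← h]
  conv_rhs => rw [← Function.Bijective.sum_comp (shift_iter_bij (m * k))]
  refine Finset.sum_congr rfl fun σ _ => ?_
  conv_rhs => rw [← Function.Bijective.sum_comp (shift_iter_bij (m * k))]
  refine Finset.sum_congr rfl fun τ _ => ?_
  rw [e, Function.iterate_add_apply, Function.iterate_add_apply]

lemma window_sum (n m N : ℕ) (hm : m ≤ n) (hN : m * N ≤ n) (K : QOp m) (hK : K.trace = 0) :
    ∑ σ, ∑ τ, Complex.normSq (∑ k : Fin N,
      embed n m hm K (shiftCfg^[m * k] σ) (shiftCfg^[m * k] τ))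
      = N * ∑ σ, ∑ τ, Complex.normSq (embed n m hm K σ τ) := by
  apply Complex.ofReal_injective
  push_cast
  simp only [Complex.normSq_eq_conj_mul_self, map_sum, Finset.sum_mul_sum]
  have h1 : ∀ k l : Fin N, ∑ σ, ∑ τ,
      (starRingEnd ℂ) (embed n m hm K (shiftCfg^[m * k] σ) (shiftCfg^[m * k] τ)) *
      embed n m hm K (shiftCfg^[m * l] σ) (shiftCfg^[m * l] τ)
      = if k = l then ∑ σ, ∑ τ, (starRingEnd ℂ) (embed n m hm K σ τ) * embed n m hm K σ τ
        else 0 := by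
    intro k l
    have hb : ∀ k : Fin N, m * (k : ℕ) + m ≤ n := fun k => by
      have : (k : ℕ) + 1 ≤ N := k.2
      nlinarith
    split_ifs with hkl
    · subst hkl
      rw [← Function.Bijective.sum_comp (shift_iter_bij (n := n) (m * k))
        (fun σ => ∑ τ, (starRingEnd ℂ) (embed n m hm K σ τ) * embed n m hm K σ τ)]
      refine Finset.sum_congr rfl fun σ _ => ?_
      rw [← Function.Bijective.sum_comp (shift_iter_bij (n := n) (m * k))
        (fun τ => (starRingEnd ℂ) (embed n m hm K _ τ) * embed n m hm K _ τ)]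
    · rcases lt_or_gt_of_ne (fun hh => hkl (Fin.ext hh) : (k : ℕ) ≠ l) with hlt | hlt
      · exact cross_zero' n m hm K hK k l hlt (hb l)
      · have := congrArg (starRingEnd ℂ) (cross_zero' n m hm K hK l k hlt (hb k))
        rw [map_zero] at this
        rw [← this]
        simp only [map_sum, map_mul, Complex.conj_conj]
        refine Finset.sum_congr rfl fun σ _ => Finset.sum_congr rfl fun τ _ => mul_comm _ _
  calc _ = ∑ k : Fin N, ∑ l : Fin N, ∑ σ, ∑ τ,
      (starRingEnd ℂ) (embed n m hm K (shiftCfg^[m * k] σ) (shiftCfg^[m * k] τ)) *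
      embed n m hm K (shiftCfg^[m * l] σ) (shiftCfg^[m * l] τ) := by
        rw [Finset.sum_congr rfl fun σ _ => Finset.sum_comm, Finset.sum_comm]
        refine Finset.sum_congr rfl fun k _ => ?_
        rw [Finset.sum_congr rfl fun σ _ => Finset.sum_comm, Finset.sum_comm]
    _ = _ := by
        simp only [h1]
        simp

lemma embed_normSq (n m : ℕ) (hm : m ≤ n) (K : QOp m) :
    ∑ σ, ∑ τ, Complex.normSq (embed n m hm K σ τ)
      = 2 ^ (n - m) * ∑ a, ∑ a', Complex.normSq (K a a') := by
  rw [sum_join n m hm]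
  simp only [sum_join n m hm (fun τ => Complex.normSq (embed n m hm K _ τ))]
  simp only [embed_join, apply_ite Complex.normSq, map_zero,
    Finset.sum_ite_eq, Finset.mem_univ, if_true]
  simp [Finset.mul_sum]

lemma ev_variance (n m N : ℕ) (hm : m ≤ n) (hN : m * N ≤ n) (hN0 : 0 < N)
    (K : QOp m) (hK : K.trace = 0)
    (v : (Fin n → Fin 2) → QState n)
    (hv : ∀ j j', ∑ σ, (starRingEnd ℂ) (v j σ) * v j' σ = if j = j' then 1 else 0)
    (ht : ∀ j, ∃ c : ℂ, ∀ σ, v j (shiftCfg σ) = c * v j σ) :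
    N * ∑ j, Complex.normSq (ev (embed n m hm K) (v j))
      ≤ 2 ^ (n - m) * ∑ a, ∑ a', Complex.normSq (K a a') := by
  have h1 := diag_sum_le v hv (Matrix.of fun σ τ => ∑ k : Fin N,
      embed n m hm K (shiftCfg^[m * k] σ) (shiftCfg^[m * k] τ))
  simp only [Matrix.of_apply] at h1
  rw [window_sum n m N hm hN K hK, embed_normSq] at h1
  have h2 : ∀ j, ev (Matrix.of fun σ τ => ∑ k : Fin N,
      embed n m hm K (shiftCfg^[m * k] σ) (shiftCfg^[m * k] τ)) (v j)
      = N * ev (embed n m hm K) (v j) := by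
    intro j
    have h3 := fun k : Fin N => ev_shift_iter (embed n m hm K) (v j) (by simpa using hv j j)
      (ht j) (m * k)
    have h4 : ev (Matrix.of fun σ τ => ∑ k : Fin N,
      embed n m hm K (shiftCfg^[m * k] σ) (shiftCfg^[m * k] τ)) (v j)
      = ∑ k : Fin N, ev ((embed n m hm K).submatrix (shiftCfg^[m * k]) (shiftCfg^[m * k])) (v j) := by
      unfold ev
      simp only [Matrix.of_apply, Matrix.submatrix_apply, Finset.mul_sum, Finset.sum_mul]
      conv_rhs => rw [Finset.sum_comm]
      refine Finset.sum_congr rfl fun σ _ => ?_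
      rw [Finset.sum_comm]
    rw [h4, Finset.sum_congr rfl fun k _ => h3 k]
    simp
  simp only [h2, Complex.normSq_mul, Complex.normSq_natCast, ← Finset.mul_sum] at h1
  have hNp : (0 : ℝ) < N := by exact_mod_cast hN0
  rw [mul_assoc] at h1
  exact le_of_mul_le_mul_left h1 hNp

lemma rdm_variance (n m N : ℕ) (hm : m ≤ n) (hN : m * N ≤ n) (hN0 : 0 < N)
    (v : (Fin n → Fin 2) → QState n)
    (hv : ∀ j j', ∑ σ, (starRingEnd ℂ) (v j σ) * v j' σ = if j = j' then 1 else 0)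
    (ht : ∀ j, ∃ c : ℂ, ∀ σ, v j (shiftCfg σ) = c * v j σ) (a a' : Fin m → Fin 2) :
    N * ∑ j, Complex.normSq (rdm n m (v j) a a' - if a = a' then ((2 : ℂ) ^ m)⁻¹ else 0)
      ≤ 2 ^ (n - m) * (2 ^ m * 2 ^ m * 4) := by
  set K : QOp m := Matrix.single a' a 1 - (if a = a' then ((2 : ℂ) ^ m)⁻¹ else 0) • 1 with hKd
  have hK : K.trace = 0 := by
    rw [hKd, Matrix.trace_sub, Matrix.trace_smul, Matrix.trace_one]
    by_cases haa : a = a'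
    · subst haa
      simp
    · rw [Matrix.trace_single_eq_of_ne _ _ _ (Ne.symm haa)]; simp [haa]
  have h1 := ev_variance n m N hm hN hN0 K hK v hv ht
  have h2 : ∀ j, ev (embed n m hm K) (v j)
      = rdm n m (v j) a a' - if a = a' then ((2 : ℂ) ^ m)⁻¹ else 0 := by
    intro j
    rw [ev_embed, hKd, Matrix.mul_sub, Matrix.trace_sub, Matrix.mul_smul, Matrix.mul_one,
      Matrix.trace_smul, rdm_trace n m hm (v j) (by simpa using hv j j), Matrix.trace_mul_single]
    simp
  simp only [h2] at h1
  refine h1.trans ?_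
  apply mul_le_mul_of_nonneg_left _ (by positivity)
  have h3 : ∀ x y, Complex.normSq (K x y) ≤ 4 := by
    intro x y
    rw [Complex.normSq_eq_norm_sq]
    have hn1 : ‖(Matrix.single a' a 1 : QOp m) x y‖ ≤ 1 := by
      rw [Matrix.single_apply]; split_ifs <;> simp
    have hn2 : ‖((if a = a' then ((2 : ℂ) ^ m)⁻¹ else 0) • (1 : QOp m)) x y‖ ≤ 1 := by
      rw [Matrix.smul_apply, Matrix.one_apply]
      have : ((2 : ℝ) ^ m)⁻¹ ≤ 1 := inv_le_one_of_one_le₀ (one_le_pow₀ (by norm_num))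
      split_ifs <;> simp [this]
    have hn3 : ‖K x y‖ ≤ 2 := by
      rw [hKd, Matrix.sub_apply]
      exact (norm_sub_le _ _).trans (by linarith)
    nlinarith [norm_nonneg (K x y)]
  calc ∑ a, ∑ a', Complex.normSq (K a a') ≤ ∑ a : Fin m → Fin 2, ∑ a' : Fin m → Fin 2, (4 : ℝ) :=
        Finset.sum_le_sum fun x _ => Finset.sum_le_sum fun y _ => h3 x y
    _ = _ := by simp; ring

lemma lower_avg (n m : ℕ) (hm0 : 0 < m) (hn : 2 * m ≤ n)
    (v : (Fin n → Fin 2) → QState n)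
    (hv : ∀ j j', ∑ σ, (starRingEnd ℂ) (v j σ) * v j' σ = if j = j' then 1 else 0)
    (ht : ∀ j, ∃ c : ℂ, ∀ σ, v j (shiftCfg σ) = c * v j σ) :
    m * Real.log 2 - (8 * m * (2 ^ m) ^ 4 : ℝ) / n
      ≤ (2 ^ n : ℝ)⁻¹ * ∑ j, entEntropy n m (v j) := by
  have hm : m ≤ n := by omega
  set N := n / m with hNd
  have hN : m * N ≤ n := Nat.mul_div_le n m
  have hN0 : 0 < N := Nat.div_pos hm hm0
  have hn2 : n ≤ 2 * m * N := by
    have h1 : n < m * (N + 1) := by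
      have := Nat.lt_div_mul_add (a := n) hm0
      rw [← hNd] at this
      nlinarith
    nlinarith
  have hvar := rdm_variance n m N hm hN hN0 v hv ht
  set S := fun a a' => ∑ j, Complex.normSq (rdm n m (v j) a a' -
    if a = a' then ((2 : ℂ) ^ m)⁻¹ else 0) with hS
  have hlow : ∀ j, m * Real.log 2 - 2 ^ m * ∑ a, ∑ a', Complex.normSq (rdm n m (v j) a a' -
      if a = a' then ((2 : ℂ) ^ m)⁻¹ else 0) ≤ entEntropy n m (v j) := by
    intro j
    have := entropy_lower (rdm n m (v j)) (rdm_posSemidef _ _ _)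
      (rdm_trace n m hm (v j) (by simpa using hv j j))
    unfold entEntropy
    simpa using this
  have h1 : (2 ^ n : ℝ) * (m * Real.log 2) - 2 ^ m * ∑ a, ∑ a', S a a'
      ≤ ∑ j, entEntropy n m (v j) := by
    refine le_trans (le_of_eq ?_) (Finset.sum_le_sum fun j _ => hlow j)
    rw [Finset.sum_sub_distrib, ← Finset.mul_sum]
    congr 1
    · simp; ring
    · rw [← Finset.mul_sum]
      congr 1
      conv_rhs => rw [Finset.sum_comm]
      refine Finset.sum_congr rfl fun a _ => ?_
      rw [Finset.sum_comm]
  have hNp : (0 : ℝ) < N := by exact_mod_cast hN0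
  have hnp : (0 : ℝ) < n := by
    have : 0 < n := by omega
    exact_mod_cast this
  have hd : (2 : ℝ) ^ (n - m) * 2 ^ m = 2 ^ n := by rw [← pow_add]; congr 1; omega
  have h2 : ∀ a a', S a a' ≤ 2 ^ n * 2 ^ m * 4 / N := by
    intro a a'
    rw [le_div_iff₀ hNp]
    have := hvar a a'
    calc S a a' * N = N * S a a' := mul_comm _ _
      _ ≤ _ := this
      _ = _ := by rw [← hd]; ring
  have h3 : ∑ a, ∑ a', S a a' ≤ 2 ^ m * 2 ^ m * (2 ^ n * 2 ^ m * 4 / N) := by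
    calc _ ≤ ∑ a : Fin m → Fin 2, ∑ a' : Fin m → Fin 2, ((2 : ℝ) ^ n * 2 ^ m * 4 / N) :=
          Finset.sum_le_sum fun x _ => Finset.sum_le_sum fun y _ => h2 x y
      _ = _ := by simp; ring
  have h4 : (1 : ℝ) / N ≤ 2 * m / n := by
    rw [div_le_div_iff₀ hNp hnp]
    have : (n : ℝ) ≤ 2 * m * N := by exact_mod_cast hn2
    linarith
  have h2n : (0 : ℝ) < 2 ^ n := by positivity
  rw [inv_mul_eq_div, le_div_iff₀ h2n]
  have h5 : (2 : ℝ) ^ m * ∑ a, ∑ a', S a a' ≤ (8 * m * (2 ^ m) ^ 4 : ℝ) / n * 2 ^ n := by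
    calc _ ≤ (2 : ℝ) ^ m * (2 ^ m * 2 ^ m * (2 ^ n * 2 ^ m * 4 / N)) :=
          mul_le_mul_of_nonneg_left h3 (by positivity)
      _ = (2 ^ m) ^ 4 * 4 * 2 ^ n * (1 / N) := by ring
      _ ≤ (2 ^ m) ^ 4 * 4 * 2 ^ n * (2 * m / n) := mul_le_mul_of_nonneg_left h4 (by positivity)
      _ = _ := by ring
  linarith

lemma meanSq_const (n m : ℕ) (hm : m ≤ n) (hm2 : 2 ≤ m)
    (h : Matrix (Fin 2 × Fin 2) (Fin 2 × Fin 2) ℂ) :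
    (((twoSite n h ⟨0, by omega⟩) * (twoSite n h ⟨0, by omega⟩)).trace).re / 2 ^ n
      = (((twoSite m h ⟨0, by omega⟩) * (twoSite m h ⟨0, by omega⟩)).trace).re / 2 ^ m := by
  rw [twoSite_embed n m hm h 0 (by omega), trace_embed_mul]
  have hd : (2 : ℝ) ^ n = 2 ^ (n - m) * 2 ^ m := by rw [← pow_add]; congr 1; omega
  have : ((2 : ℂ) ^ (n - m)) = (((2 : ℝ) ^ (n - m) : ℝ) : ℂ) := by push_cast; rfl
  rw [hd, this, Complex.re_ofReal_mul, mul_div_mul_left _ _ (by positivity)]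

lemma trace_H_sq (n : ℕ) (hn : 0 < n) (h : Matrix (Fin 2 × Fin 2) (Fin 2 × Fin 2) ℂ)
    (horth : ∀ i i' : Fin n, i ≠ i' → ((twoSite n h i) * (twoSite n h i')).trace = 0) :
    ((∑ i, twoSite n h i) * (∑ i, twoSite n h i)).trace
      = n * ((twoSite n h ⟨0, hn⟩) * (twoSite n h ⟨0, hn⟩)).trace := by
  have h1 : ∀ (i : ℕ) (hi : i < n), ((twoSite n h ⟨i, hi⟩) * (twoSite n h ⟨i, hi⟩)).trace
      = ((twoSite n h ⟨0, hn⟩) * (twoSite n h ⟨0, hn⟩)).trace := by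
    intro i
    induction i with
    | zero => intro _; rfl
    | succ k ih =>
      intro hi
      have hs : (⟨k + 1, hi⟩ : Fin n) = finSucc ⟨k, by omega⟩ := by
        simp [finSucc, Nat.mod_eq_of_lt hi]
      rw [← ih (by omega), hs, twoSite_shift]
      simp only [Matrix.trace, Matrix.diag, Matrix.mul_apply, Matrix.submatrix_apply]
      conv_rhs => rw [← Function.Bijective.sum_comp shiftCfg_bij]
      refine Finset.sum_congr rfl fun σ _ => ?_
      conv_rhs => rw [← Function.Bijective.sum_comp shiftCfg_bij]
  rw [Matrix.sum_mul, Matrix.trace_sum]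
  have h2 : ∀ i : Fin n, (twoSite n h i * ∑ i, twoSite n h i).trace
      = ((twoSite n h ⟨0, hn⟩) * (twoSite n h ⟨0, hn⟩)).trace := by
    intro i
    rw [Matrix.mul_sum, Matrix.trace_sum, Finset.sum_eq_single i]
    · exact h1 i i.2
    · intro j _ hj
      exact horth i j (Ne.symm hj)
    · simp
  rw [Finset.sum_congr rfl fun i _ => h2 i]
  simp

lemma upper_avg (n m : ℕ) (hm2 : 2 ≤ m) (hme : Even m) (hn : m ≤ n)
    (h : Matrix (Fin 2 × Fin 2) (Fin 2 × Fin 2) ℂ) (hh : h.IsHermitian) (htr : h.trace = 0)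
    (horth : ∀ i i' : Fin n, i ≠ i' → ((twoSite n h i) * (twoSite n h i')).trace = 0)
    (hnorm : opNorm (twoSite n h ⟨0, by omega⟩) = 1)
    (v : (Fin n → Fin 2) → QState n) (E : (Fin n → Fin 2) → ℝ)
    (hv : ∀ j j', ∑ σ, (starRingEnd ℂ) (v j σ) * v j' σ = if j = j' then 1 else 0)
    (hE : ∀ j, (∑ i, twoSite n h i).mulVec (v j) = (E j : ℂ) • v j)
    (ht : ∀ j, ∃ c : ℂ, ∀ σ, v j (shiftCfg σ) = c * v j σ) :
    (2 ^ n : ℝ)⁻¹ * ∑ j, entEntropy n m (v j)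
          ≤ m * Real.log 2 -
            m * ((((twoSite n h ⟨0, by omega⟩) * (twoSite n h ⟨0, by omega⟩)).trace).re / 2 ^ n) /
              (4 * n) := by
  obtain ⟨r, rfl⟩ := hme
  have hb := eig_bound n (by omega) h hh hnorm
  have h1 : ∀ j, entEntropy n (r + r) (v j) ≤
      ((r + r : ℕ) : ℝ) * Real.log 2 - ((r + r : ℕ) : ℝ) * (E j / n) ^ 2 / 4 := by
    intro j
    have hj : ∑ σ, (starRingEnd ℂ) (v j σ) * v j σ = 1 := by simpa using hv j j
    exact upper_state n r hn h hh htr hb (v j) hj (E j / n)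
      (fun i hi => ev_eigen h (v j) hj (ht j) (E j) (hE j) i hi)
  have h2 := energy_sum v E hv _ hE
  rw [trace_H_sq n (by omega) h horth] at h2
  have h3 := congrArg Complex.re h2
  rw [Complex.ofReal_re, ← Complex.ofReal_natCast, Complex.re_ofReal_mul] at h3
  have hnp : (0 : ℝ) < n := by
    have : 0 < n := by omega
    exact_mod_cast this
  have h2n : (0 : ℝ) < 2 ^ n := by positivity
  have h4 := Finset.sum_le_sum fun j (_ : j ∈ Finset.univ) => h1 j
  have h5 : ∑ j : Fin n → Fin 2, (((r + r : ℕ) : ℝ) * Real.log 2 - ((r + r : ℕ) : ℝ) * (E j / n) ^ 2 / 4)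
      = 2 ^ n * (((r + r : ℕ) : ℝ) * Real.log 2) - ((r + r : ℕ) : ℝ) / (4 * n ^ 2) * ∑ j, E j ^ 2 := by
    rw [Finset.sum_sub_distrib, Finset.mul_sum]
    congr 1
    · simp
    · refine Finset.sum_congr rfl fun j _ => ?_
      field_simp
  rw [h5, h3] at h4
  rw [inv_mul_eq_div, div_le_iff₀ h2n]
  refine h4.trans (le_of_eq ?_)
  field_simp

/-- For a fixed even region size `2 ≤ m = O(1)`, the average eigenstate entanglement entropy of
a chaotic translationally invariant chain with `⟨H₁²⟩ > 0` and `‖Hᵢ‖ = 1` satisfies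
`m ln 2 - c₁/n ≤ S̄ ≤ m ln 2 - c₂/n` for constants `c₁ ≥ c₂ > 0` independent of `n`; in
particular the upper bound `S̄ ≤ m ln 2 - m ⟨H₁²⟩/(4n)` holds. -/
theorem small_region_average_entanglement
    (m : ℕ) (hm2 : 2 ≤ m) (hmeven : Even m)
    (h : Matrix (Fin 2 × Fin 2) (Fin 2 × Fin 2) ℂ)
    (hherm : h.IsHermitian) (htr : h.trace = 0)
    (horth : ∀ n : ℕ, ∀ _ : 2 * m ≤ n, ∀ i i' : Fin n, i ≠ i' →
      ((twoSite n h i) * (twoSite n h i')).trace = 0)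
    (hnorm : ∀ n : ℕ, ∀ _ : 2 * m ≤ n, ∀ i : Fin n, opNorm (twoSite n h i) = 1)
    (hpos : ∀ n : ℕ, ∀ hn : 2 * m ≤ n,
      0 < (((twoSite n h ⟨0, by omega⟩) * (twoSite n h ⟨0, by omega⟩)).trace).re / 2 ^ n) :
    ∃ c₁ c₂ : ℝ, 0 < c₂ ∧ c₂ ≤ c₁ ∧
      ∀ n : ℕ, ∀ hn : 2 * m ≤ n,
      ∀ (v : (Fin n → Fin 2) → QState n) (E : (Fin n → Fin 2) → ℝ),
        (∀ j j', ∑ σ, (starRingEnd ℂ) (v j σ) * v j' σ = if j = j' then 1 else 0) →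
        (∀ j, (∑ i, twoSite n h i).mulVec (v j) = (E j : ℂ) • v j) →
        (∀ j, ∃ c : ℂ, ∀ σ, v j (shiftCfg σ) = c * v j σ) →
        m * Real.log 2 - c₁ / n ≤ (2 ^ n : ℝ)⁻¹ * ∑ j, entEntropy n m (v j) ∧
        (2 ^ n : ℝ)⁻¹ * ∑ j, entEntropy n m (v j) ≤ m * Real.log 2 - c₂ / n ∧
        (2 ^ n : ℝ)⁻¹ * ∑ j, entEntropy n m (v j)
          ≤ m * Real.log 2 -
            m * ((((twoSite n h ⟨0, by omega⟩) * (twoSite n h ⟨0, by omega⟩)).trace).re / 2 ^ n) /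
              (4 * n) := by
  set q : ℝ := (((twoSite m h ⟨0, by omega⟩) * (twoSite m h ⟨0, by omega⟩)).trace).re / 2 ^ m with hq
  have hq0 : 0 < q := by
    have := hpos (2 * m) le_rfl
    rwa [meanSq_const (2 * m) m (by omega) hm2] at this
  have hmp : (0 : ℝ) < m := by
    have : 0 < m := by omega
    exact_mod_cast this
  refine ⟨max (8 * m * (2 ^ m) ^ 4) (m * q / 4), m * q / 4, by positivity, le_max_right _ _, ?_⟩
  intro n hn v E hv hE ht
  have hnp : (0 : ℝ) < n := by
    have : 0 < n := by omega
    exact_mod_cast this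
  have hup := upper_avg n m hm2 hmeven (by omega) h hherm htr (horth n hn) (hnorm n hn _) v E hv hE ht
  refine ⟨?_, ?_, hup⟩
  · refine le_trans ?_ (lower_avg n m (by omega) hn v hv ht)
    have := div_le_div_of_nonneg_right (le_max_left (8 * m * (2 ^ m) ^ 4 : ℝ) (m * q / 4)) hnp.le
    linarith
  · rw [meanSq_const n m (by omega) hm2, ← hq] at hup
    refine hup.trans (le_of_eq ?_)
    field_simp
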